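/- arXiv:math/0612843 — 6 statements merged into one kernel-verified Lean document; each statement's English description precedes it below -/
import Mathlib

section
/- Let k ≥ 1 be an integer and let f : ℝ → ℝ be infinitely differentiable. Then the triple Vandermonde differential operator identity holds: ∑_{σ ∈ S_{2k}} ∑_{μ ∈ S_k} ∑_{ν ∈ S_k} sgn(σ)·sgn(μ)·sgn(ν) · ∏_{i=0}^{k−1} f^{(σ(i)+μ(i))}(1) · ∏_{i=0}^{k−1} f^{(σ(k+i)+ν(i))}(−1) = (k!)² · det D, where D is the 2k×2k real matrix with rows and columns indexed by 0,…,2k−1 whose entry in row i and column j equals f^{(i+j)}(1) for 0 ≤ i ≤ k−1 and equals f^{(i−k+j)}(−1) for k ≤ i ≤ 2k−1. -/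
open scoped BigOperators

/-- Permuting the rows of a square matrix within two complementary blocks multiplies the
Leibniz expansion of its determinant by the product of the two signs. -/
theorem sum_sign_mul_prod_block_permute {m n ι R : Type*} [Fintype m] [DecidableEq m]
    [Fintype n] [DecidableEq n] [Fintype ι] [DecidableEq ι] [CommRing R]
    (e : m ⊕ n ≃ ι) (M : Matrix ι ι R) (μ : Equiv.Perm m) (ν : Equiv.Perm n) :
    ∑ σ : Equiv.Perm ι, (((Equiv.Perm.sign σ : ℤ) : R)) *
        ((∏ i, M (e (Sum.inl (μ i))) (σ (e (Sum.inl i)))) *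
          ∏ i, M (e (Sum.inr (ν i))) (σ (e (Sum.inr i)))) =
      ((Equiv.Perm.sign μ : ℤ) : R) * ((Equiv.Perm.sign ν : ℤ) : R) * M.det := by
  have h := Matrix.det_permute (e.permCongr (Equiv.Perm.sumCongr μ ν)) M
  rw [Equiv.Perm.sign_permCongr, Equiv.Perm.sign_sumCongr] at h
  push_cast at h
  rw [← h, ← Matrix.det_transpose, Matrix.det_apply']
  refine Finset.sum_congr rfl fun σ _ => ?_
  rw [← e.prod_comp, Fintype.prod_sum_type]
  simp [Equiv.permCongr_apply]

/-- the triple Vandermonde differential operator identity. -/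
theorem triple_vandermonde_identity (k : ℕ) (hk : 1 ≤ k) (f : ℝ → ℝ)
    (hf : ContDiff ℝ (⊤ : ℕ∞) f) :
    ∑ σ : Equiv.Perm (Fin (2 * k)), ∑ μ : Equiv.Perm (Fin k), ∑ ν : Equiv.Perm (Fin k),
      (((Equiv.Perm.sign σ : ℤ) * (Equiv.Perm.sign μ : ℤ) * (Equiv.Perm.sign ν : ℤ) : ℤ) : ℝ) *
        ((∏ i : Fin k, iteratedDeriv
            ((σ (Fin.cast (two_mul k).symm (Fin.castAdd k i)) : ℕ) + (μ i : ℕ)) f 1) *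
         (∏ i : Fin k, iteratedDeriv
            ((σ (Fin.cast (two_mul k).symm (Fin.natAdd k i)) : ℕ) + (ν i : ℕ)) f (-1)))
    = ((Nat.factorial k : ℝ)) ^ 2 *
      Matrix.det (Matrix.of fun i j : Fin (2 * k) =>
        if (i : ℕ) < k then iteratedDeriv ((i : ℕ) + (j : ℕ)) f 1
        else iteratedDeriv (((i : ℕ) - k) + (j : ℕ)) f (-1)) := by
  set D : Matrix (Fin (2 * k)) (Fin (2 * k)) ℝ := Matrix.of fun i j : Fin (2 * k) =>
    if (i : ℕ) < k then iteratedDeriv ((i : ℕ) + (j : ℕ)) f 1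
    else iteratedDeriv (((i : ℕ) - k) + (j : ℕ)) f (-1) with hD
  have sign_sq (π : Equiv.Perm (Fin k)) :
      ((Equiv.Perm.sign π : ℤ) : ℝ) * ((Equiv.Perm.sign π : ℤ) : ℝ) = 1 := by
    rw [← Int.cast_mul, ← Units.val_mul, Int.units_mul_self, Units.val_one, Int.cast_one]
  have inner (μ ν : Equiv.Perm (Fin k)) :
      ∑ σ : Equiv.Perm (Fin (2 * k)),
        (((Equiv.Perm.sign σ : ℤ) * (Equiv.Perm.sign μ : ℤ) * (Equiv.Perm.sign ν : ℤ) : ℤ) : ℝ) *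
          ((∏ i : Fin k, iteratedDeriv
              ((σ (Fin.cast (two_mul k).symm (Fin.castAdd k i)) : ℕ) + (μ i : ℕ)) f 1) *
           (∏ i : Fin k, iteratedDeriv
              ((σ (Fin.cast (two_mul k).symm (Fin.natAdd k i)) : ℕ) + (ν i : ℕ)) f (-1)))
      = D.det := by
    have h := sum_sign_mul_prod_block_permute
      (finSumFinEquiv.trans (finCongr (two_mul k).symm)) D μ ν
    calc
      _ = ((Equiv.Perm.sign μ : ℤ) : ℝ) * ((Equiv.Perm.sign ν : ℤ) : ℝ) *
          (((Equiv.Perm.sign μ : ℤ) : ℝ) * ((Equiv.Perm.sign ν : ℤ) : ℝ) * D.det) := by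
        rw [← h, Finset.mul_sum]
        refine Finset.sum_congr rfl fun σ _ => ?_
        simp [hD, add_comm]
        ring
      _ = D.det := by
        linear_combination D.det * ((Equiv.Perm.sign ν : ℤ) : ℝ) ^ 2 * sign_sq μ +
          D.det * sign_sq ν
  rw [Finset.sum_comm]
  simp_rw [Finset.sum_comm (s := (Finset.univ : Finset (Equiv.Perm (Fin (2 * k))))), inner]
  simp [Fintype.card_perm]
  ring
end

section
/- Let A, B, C be integers with A ≥ 1, B ≥ 1, C ≥ 0, and let t be a real number with 0 ≤ t < 1. Then ∫₀¹ (1 − e(θ)·t^{1/2})^{−A} · (1 − e(−θ)·t^{1/2})^{−B} · e(Cθ) dθ = t^{C/2} · binom(B+C−1, C) · ₂F₁(A, B+C; C+1; t), where the integral is the (complex-valued) integral over the real variable θ ∈ [0,1]. -/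
open scoped BigOperators

/-- `e θ = exp(2πiθ)`. -/
noncomputable def e (θ : ℝ) : ℂ := Complex.exp (2 * Real.pi * Complex.I * θ)

/-- Gauss hypergeometric series `₂F₁(a,b;c;t)` for natural parameters, via rising
factorials. -/
noncomputable def gauss2F1 (a b c : ℕ) (t : ℝ) : ℝ :=
  ∑' n : ℕ, ((Nat.ascFactorial a n : ℝ) * (Nat.ascFactorial b n : ℝ)) /
    ((Nat.ascFactorial c n : ℝ) * (Nat.factorial n : ℝ)) * t ^ n

lemma e_eq_exp_mul (x θ : ℝ) : e (x * θ) = Complex.exp (2 * Real.pi * Complex.I * x * θ) := by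
  simp only [e]
  push_cast
  ring_nf

lemma norm_e (θ : ℝ) : ‖e θ‖ = 1 := by
  rw [e, show (2 * Real.pi * Complex.I * θ : ℂ) = ((2 * Real.pi * θ : ℝ) : ℂ) * Complex.I by
    push_cast; ring]
  exact Complex.norm_exp_ofReal_mul_I _

lemma continuous_e : Continuous e := by
  unfold e
  fun_prop

lemma e_add (x y : ℝ) : e (x + y) = e x * e y := by
  rw [e, e, e, ← Complex.exp_add]
  push_cast
  ring_nf

lemma e_pow (θ : ℝ) (n : ℕ) : e θ ^ n = e (n * θ) := by
  rw [e, e, ← Complex.exp_nat_mul]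
  push_cast
  ring_nf

lemma integral_e_int_mul (k : ℤ) :
    (∫ θ in (0 : ℝ)..1, e ((k : ℝ) * θ)) = if k = 0 then 1 else 0 := by
  split_ifs with h
  · simp [h, e]
  · have hc : (2 * Real.pi * Complex.I * ((k : ℝ) : ℂ)) ≠ 0 := by
      simp [h, Real.pi_ne_zero]
    simp_rw [e_eq_exp_mul]
    rw [integral_exp_mul_complex hc]
    have h1 : Complex.exp (2 * Real.pi * Complex.I * ((k : ℝ) : ℂ)) = 1 := by
      rw [Complex.exp_eq_one_iff]
      exact ⟨k, by push_cast; ring⟩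
    rw [Complex.ofReal_one, mul_one, h1]
    simp

lemma choose_mul_ascFactorial_succ (b C m : ℕ) :
    (m + C + b).choose b * (C + 1).ascFactorial m =
      (b + C).choose C * (b + C + 1).ascFactorial m := by
  have h1 := Nat.factorial_mul_ascFactorial C m
  have h2 := Nat.factorial_mul_ascFactorial (b + C) m
  have h3 := Nat.add_choose_mul_factorial_mul_factorial (m + C) b
  have h4 := Nat.add_choose_mul_factorial_mul_factorial b C
  have hpos : 0 < b.factorial * C.factorial := by positivity
  apply Nat.eq_of_mul_eq_mul_left hpos
  calc b.factorial * C.factorial * ((m + C + b).choose b * (C + 1).ascFactorial m)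
      = (m + C + b).choose b * (C.factorial * (C + 1).ascFactorial m) * b.factorial := by ring
    _ = (m + C + b).factorial := by rw [h1, add_comm C m, h3]
    _ = (b + C).factorial * (b + C + 1).ascFactorial m := by rw [h2]; congr 1; ring
    _ = _ := by rw [← h4]; ring

lemma choose_mul_choose_eq_hypergeometric_coeff (a b C m : ℕ) :
    ((m + a).choose a : ℝ) * ((m + C + b).choose b : ℝ) =
      ((b + C).choose C : ℝ) *
        ((((a + 1).ascFactorial m : ℝ) * ((b + C + 1).ascFactorial m : ℝ)) /
          (((C + 1).ascFactorial m : ℝ) * (m.factorial : ℝ))) := by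
  have h1 : ((m + C + b).choose b * (C + 1).ascFactorial m : ℝ) =
      (b + C).choose C * (b + C + 1).ascFactorial m := by
    exact_mod_cast choose_mul_ascFactorial_succ b C m
  have h2 : ((a + 1).ascFactorial m : ℝ) = m.factorial * (m + a).choose a := by
    rw [Nat.ascFactorial_eq_factorial_mul_choose, ← Nat.choose_symm_add, add_comm a m]
    push_cast
    rfl
  have h3 : ((C + 1).ascFactorial m : ℝ) ≠ 0 := by
    exact_mod_cast (Nat.ascFactorial_pos C m).ne'
  have h4 : (m.factorial : ℝ) ≠ 0 := by positivity
  rw [h2]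
  field_simp
  linear_combination ((m + a).choose a : ℝ) * h1

/-- The Fourier expansion of `(1 - e(θ) s)⁻ᵃ⁻¹ (1 - e(-θ) s)⁻ᵇ⁻¹ e(Cθ)`, integrated termwise. -/
lemma hasSum_integral_one_sub_e_mul_zpow (a b C : ℕ) {s : ℝ} (hs0 : 0 ≤ s) (hs1 : s < 1) :
    HasSum (fun m : ℕ => (((m + a).choose a : ℝ) * ((m + C + b).choose b : ℝ) *
        s ^ (m + (m + C)) : ℂ))
      (∫ θ in (0 : ℝ)..1, (1 - e θ * (s : ℂ)) ^ (-((a + 1 : ℕ) : ℤ)) *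
        (1 - e (-θ) * (s : ℂ)) ^ (-((b + 1 : ℕ) : ℤ)) * e ((C : ℝ) * θ)) := by
  have hns : ‖s‖ < 1 := by rwa [Real.norm_of_nonneg hs0]
  have hsum (k : ℕ) : Summable fun n : ℕ => ((n + k).choose k : ℝ) * s ^ n :=
    (hasSum_choose_mul_geometric_of_norm_lt_one k hns).summable
  have hsum_prod : Summable fun p : ℕ × ℕ =>
      (((p.1 + a).choose a : ℝ) * s ^ p.1) * (((p.2 + b).choose b : ℝ) * s ^ p.2) :=
    (hsum a).mul_of_nonneg (hsum b) (fun _ => by positivity) (fun _ => by positivity)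
  have hexp (k : ℕ) (θ : ℝ) : HasSum (fun n : ℕ => ((n + k).choose k : ℂ) * (e θ * s) ^ n)
      ((1 - e θ * (s : ℂ)) ^ (-((k + 1 : ℕ) : ℤ))) := by
    have h : ‖e θ * (s : ℂ)‖ < 1 := by simpa [norm_e] using hns
    rw [zpow_neg, zpow_natCast, ← one_div]
    exact hasSum_choose_mul_geometric_of_norm_lt_one k h
  let F : ℕ × ℕ → ℝ → ℂ := fun p θ => (((p.1 + a).choose a : ℂ) * (e θ * s) ^ p.1) *
    (((p.2 + b).choose b : ℂ) * (e (-θ) * s) ^ p.2) * e ((C : ℝ) * θ)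
  have hnorm (p : ℕ × ℕ) (θ : ℝ) : ‖F p θ‖ =
      (((p.1 + a).choose a : ℝ) * s ^ p.1) * (((p.2 + b).choose b : ℝ) * s ^ p.2) := by
    simp [F, norm_e, abs_of_nonneg hs0]
  have hF (θ : ℝ) : HasSum (fun p => F p θ) ((1 - e θ * (s : ℂ)) ^ (-((a + 1 : ℕ) : ℤ)) *
        (1 - e (-θ) * (s : ℂ)) ^ (-((b + 1 : ℕ) : ℤ)) * e ((C : ℝ) * θ)) := by
    have hab : Summable fun p : ℕ × ℕ => (((p.1 + a).choose a : ℂ) * (e θ * s) ^ p.1) *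
        (((p.2 + b).choose b : ℂ) * (e (-θ) * s) ^ p.2) := by
      refine Summable.of_norm (hsum_prod.congr fun p => ?_)
      simp [norm_e, abs_of_nonneg hs0]
    exact ((hexp a θ).mul (hexp b (-θ)) hab).mul_right _
  have key := intervalIntegral.hasSum_integral_of_dominated_convergence
    (μ := MeasureTheory.volume) (a := 0) (b := 1) (F := F)
    (fun p _ => (((p.1 + a).choose a : ℝ) * s ^ p.1) * (((p.2 + b).choose b : ℝ) * s ^ p.2))
    (fun p => by
      have := continuous_e
      exact Continuous.aestronglyMeasurable (by fun_prop))
    (fun p => .of_forall fun θ _ => (hnorm p θ).le)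
    (.of_forall fun θ _ => hsum_prod)
    intervalIntegrable_const
    (.of_forall fun θ _ => hF θ)
  have hint (p : ℕ × ℕ) : (∫ θ in (0 : ℝ)..1, F p θ) =
      ((p.1 + a).choose a : ℂ) * ((p.2 + b).choose b : ℂ) * s ^ (p.1 + p.2) *
        if (p.1 - p.2 + C : ℤ) = 0 then 1 else 0 := by
    rw [← integral_e_int_mul, ← intervalIntegral.integral_const_mul]
    congr 1 with θ
    have : e (((p.1 - p.2 + C : ℤ) : ℝ) * θ) = e (p.1 * θ) * e (p.2 * -θ) * e (C * θ) := by
      rw [← e_add, ← e_add]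
      push_cast
      ring_nf
    rw [this]
    simp only [F, mul_pow, e_pow]
    ring
  have hinj : Function.Injective fun m : ℕ => (m, m + C) := fun m n h => (Prod.mk.inj h).1
  rw [← hinj.hasSum_iff] at key
  · have hdiag : (fun p => ∫ θ in (0 : ℝ)..1, F p θ) ∘ (fun m : ℕ => (m, m + C)) = fun m : ℕ =>
        (((m + a).choose a : ℝ) * ((m + C + b).choose b : ℝ) * s ^ (m + (m + C)) : ℂ) := by
      ext m
      simp [hint]
    rwa [hdiag] at key
  · rintro ⟨m, n⟩ hmn
    rw [hint, if_neg, mul_zero]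
    intro h
    exact hmn ⟨m, by simp; omega⟩

/-- the integral formula of Lemma `lemma:hyper`, case `C ≥ 0`. -/
theorem hyper_integral_nonneg (A B C : ℕ) (hA : 1 ≤ A) (hB : 1 ≤ B)
    (t : ℝ) (ht0 : 0 ≤ t) (ht1 : t < 1) :
    (∫ θ in (0:ℝ)..1,
      (1 - e θ * (Real.sqrt t : ℂ)) ^ (-(A : ℤ)) *
      (1 - e (-θ) * (Real.sqrt t : ℂ)) ^ (-(B : ℤ)) *
      e ((C : ℝ) * θ))
    = ((Real.sqrt t ^ C : ℝ) : ℂ) * ((Nat.choose (B + C - 1) C : ℕ) : ℂ) *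
      ((gauss2F1 A (B + C) (C + 1) t : ℝ) : ℂ) := by
  obtain ⟨a, rfl⟩ := Nat.exists_eq_add_of_le' hA
  obtain ⟨b, rfl⟩ := Nat.exists_eq_add_of_le' hB
  have hs1 : Real.sqrt t < 1 := by rwa [Real.sqrt_lt' one_pos, one_pow]
  rw [← (hasSum_integral_one_sub_e_mul_zpow a b C (Real.sqrt_nonneg t) hs1).tsum_eq,
    show b + 1 + C - 1 = b + C by omega, show b + 1 + C = b + C + 1 by omega, gauss2F1,
    Complex.ofReal_tsum, ← tsum_mul_left]
  refine tsum_congr fun m => ?_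
  have ht : Real.sqrt t ^ (m + (m + C)) = Real.sqrt t ^ C * t ^ m := by
    rw [← add_assoc, pow_add, ← two_mul, pow_mul, Real.sq_sqrt ht0, mul_comm]
  have h := choose_mul_choose_eq_hypergeometric_coeff a b C m
  rw [← Complex.ofReal_natCast ((b + C).choose C), ← Complex.ofReal_mul, ← Complex.ofReal_mul]
  norm_cast at h ⊢
  rw [ht, h]
  ring
end

section
/- Let k ≥ 1 be an integer and let a, b : {0,…,k−1} → ℕ be tuples, with |a| := a_0 + ⋯ + a_{k−1} and |b| := b_0 + ⋯ + b_{k−1}. If det M_k(a,b) ≠ 0, then a_i = 0 for every index i with i + |a| < k, and b_i = 0 for every index i with i + |b| < k. -/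
open scoped BigOperators

/-- `Γinv m = 1/(m-1)!` for `m ≥ 1` and `0` for `m ≤ 0`. -/
noncomputable def Γinv (m : ℤ) : ℝ :=
  if 1 ≤ m then 1 / (Nat.factorial (m - 1).toNat : ℝ) else 0

/-- The `2k × 2k` matrix `M_k(a,b)` of the paper. -/
noncomputable def Mmat (k : ℕ) (a b : Fin k → ℕ) :
    Matrix (Fin (2 * k)) (Fin (2 * k)) ℝ :=
  Matrix.of fun i j =>
    if h : (i : ℕ) < k then
      Γinv ((2 * k : ℤ) - (i : ℕ) - (j : ℕ) - a ⟨(i : ℕ), h⟩)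
    else
      (-1 : ℝ) ^ ((i : ℕ) + (j : ℕ) + 1) *
        Γinv ((2 * k : ℤ) - ((i : ℕ) - k) - (j : ℕ) -
          b ⟨(i : ℕ) - k, by have := i.isLt; omega⟩)

/-- A square matrix with one row a multiple of another has zero determinant. -/
theorem Matrix.det_eq_zero_of_row_eq_smul {n R : Type*} [Fintype n] [DecidableEq n] [CommRing R]
    {M : Matrix n n R} {i j : n} (hij : i ≠ j) (c : R) (h : ∀ l, M i l = c * M j l) :
    M.det = 0 := by
  have hM : M = M.updateRow i (c • M j) := by
    ext r l
    by_cases hr : r = i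
    · subst hr
      simp [h l]
    · simp [Matrix.updateRow_ne hr]
  rw [hM, Matrix.det_updateRow_smul, Matrix.det_updateRow_eq_zero hij.symm, mul_zero]

/-- If `i ↦ i + a i` is injective on `Fin k` and `a i ≠ 0`, then following the orbit of `i` under
this map until it leaves `Fin k` shows that the tail sum of `a` from `i` on is at least `k - i`. -/
theorem le_add_sum_Ici_of_injective {k : ℕ} {a : Fin k → ℕ}
    (hinj : Function.Injective fun i : Fin k => (i : ℕ) + a i) (i : Fin k) (hi : a i ≠ 0) :
    k ≤ i + ∑ j ∈ Finset.Ici i, a j := by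
  induction i using WellFoundedGT.induction with
  | ind i ih =>
    by_cases hk : k ≤ i + a i
    · have := Finset.single_le_sum (f := a) (fun _ _ => Nat.zero_le _) (Finset.mem_Ici.2 (le_refl i))
      omega
    · let i' : Fin k := ⟨i + a i, not_le.1 hk⟩
      have hlt : i < i' := Fin.lt_def.2 (by simp only [i']; omega)
      have hi' : a i' ≠ 0 := fun h0 => hlt.ne' (hinj (by simp [h0, i']))
      have hle : k ≤ i + a i + ∑ j ∈ Finset.Ici i', a j := ih i' hlt hi'
      have hsum : a i + ∑ j ∈ Finset.Ici i', a j ≤ ∑ j ∈ Finset.Ici i, a j := by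
        rw [← Finset.sum_insert (f := a) (by simpa using hlt)]
        refine Finset.sum_le_sum_of_subset (Finset.insert_subset (by simp) ?_)
        exact Finset.Ici_subset_Ici.2 hlt.le
      omega

theorem eq_zero_of_add_sum_lt_of_injective {k : ℕ} {a : Fin k → ℕ}
    (hinj : Function.Injective fun i : Fin k => (i : ℕ) + a i) (i : Fin k)
    (hi : (i : ℕ) + ∑ j, a j < k) : a i = 0 := by
  by_contra h0
  have h1 := le_add_sum_Ici_of_injective hinj i h0
  have h2 := Finset.sum_le_sum_of_subset (f := a) (Finset.subset_univ (Finset.Ici i))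
  omega

theorem Mmat_apply_upper {k : ℕ} (a b : Fin k → ℕ) (i : Fin k) (hi : (i : ℕ) < 2 * k)
    (l : Fin (2 * k)) :
    Mmat k a b ⟨i, hi⟩ l = Γinv (2 * k - l - ((i + a i : ℕ) : ℤ)) := by
  simp only [Mmat, Matrix.of_apply, i.isLt, dite_true]
  congr 1
  push_cast
  ring

theorem Mmat_apply_lower {k : ℕ} (a b : Fin k → ℕ) (i : Fin k) (hi : (i : ℕ) + k < 2 * k)
    (l : Fin (2 * k)) :
    Mmat k a b ⟨i + k, hi⟩ l =
      (-1) ^ ((i : ℕ) + k + l + 1) * Γinv (2 * k - l - ((i + b i : ℕ) : ℤ)) := by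
  have h : ¬ (i : ℕ) + k < k := by omega
  simp only [Mmat, Matrix.of_apply, h, dite_false, Nat.add_sub_cancel, Fin.eta]
  congr 2
  push_cast
  ring

theorem injective_add_left_of_det_Mmat_ne_zero {k : ℕ} {a b : Fin k → ℕ}
    (hdet : (Mmat k a b).det ≠ 0) : Function.Injective fun i : Fin k => (i : ℕ) + a i := by
  intro i j hij
  by_contra hne
  refine hdet (Matrix.det_eq_zero_of_row_eq_smul (i := ⟨i, by omega⟩) (j := ⟨j, by omega⟩)
    (by simpa [Fin.ext_iff] using hne) 1 fun l => ?_)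
  rw [Mmat_apply_upper, Mmat_apply_upper, one_mul, show (i : ℕ) + a i = j + a j from hij]

theorem injective_add_right_of_det_Mmat_ne_zero {k : ℕ} {a b : Fin k → ℕ}
    (hdet : (Mmat k a b).det ≠ 0) : Function.Injective fun i : Fin k => (i : ℕ) + b i := by
  intro i j hij
  by_contra hne
  refine hdet (Matrix.det_eq_zero_of_row_eq_smul (i := ⟨i + k, by omega⟩) (j := ⟨j + k, by omega⟩)
    (by simpa [Fin.ext_iff] using hne) ((-1) ^ ((i : ℕ) + j)) fun l => ?_)
  have hsign : (-1 : ℝ) ^ ((i : ℕ) + k + l + 1) =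
      (-1) ^ ((i : ℕ) + j) * (-1) ^ ((j : ℕ) + k + l + 1) := by
    rw [← pow_add, show (i : ℕ) + j + (j + k + l + 1) = i + k + l + 1 + 2 * j by ring,
      pow_add _ _ (2 * (j : ℕ)), pow_mul, neg_one_sq, one_pow, mul_one]
  rw [Mmat_apply_lower, Mmat_apply_lower, show (i : ℕ) + b i = j + b j from hij, hsign, mul_assoc]

/-- Lemma `lemma:det 0`; if the determinant is nonzero then the
leading entries of `a` and `b` vanish. -/
theorem det_Mmat_ne_zero_imp (k : ℕ) (hk : 1 ≤ k) (a b : Fin k → ℕ)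
    (hdet : (Mmat k a b).det ≠ 0) :
    (∀ i : Fin k, (i : ℕ) + (∑ j : Fin k, a j) < k → a i = 0) ∧
    (∀ i : Fin k, (i : ℕ) + (∑ j : Fin k, b j) < k → b i = 0) := by
  exact ⟨eq_zero_of_add_sum_lt_of_injective (injective_add_left_of_det_Mmat_ne_zero hdet),
    eq_zero_of_add_sum_lt_of_injective (injective_add_right_of_det_Mmat_ne_zero hdet)⟩
end

section
/- Let α be the one-part tuple (2) and β the empty tuple. Then for every integer k ≥ 1, N_k(α;β) = 0. -/
open scoped BigOperators

/-- `M̃_k(a,b) = (−1)^{b_0+⋯+b_{k−1}}·det M_k(a,b)`. -/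
noncomputable def Mtilde (k : ℕ) (a b : Fin k → ℕ) : ℝ :=
  (-1 : ℝ) ^ (∑ i : Fin k, b i) * (Mmat k a b).det

/-- `a : Fin k → ℕ` is a rearrangement of length `k` of the tuple `lam`:
its multiset of values consists of the parts of `lam` together with
`k − lam.length` zeros. -/
def IsRearrangement (k : ℕ) (lam : List ℕ) (a : Fin k → ℕ) : Prop :=
  Multiset.map a Finset.univ.val = (lam : Multiset ℕ) + Multiset.replicate (k - lam.length) 0

-- `N_k(α;β)` of the paper, as a finitely supported sum over all rearrangements.
open Classical in
noncomputable def Nk (k : ℕ) (α β : List ℕ) : ℝ :=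
  (2 : ℝ) ^ (((α.sum + β.sum : ℕ) : ℤ) - (k : ℤ) ^ 2) *
    (∏ l : Fin k, (Nat.factorial (l : ℕ) : ℝ) / (Nat.factorial (k + (l : ℕ)) : ℝ))⁻¹ *
    ∑ᶠ (a : Fin k → ℕ) (b : Fin k → ℕ),
      if IsRearrangement k α a ∧ IsRearrangement k β b then Mtilde k a b else 0

/-- The matrix whose rows are those of `Mmat k 0 0`, all shifted by `c` columns. -/
noncomputable def shiftedMat (k c : ℕ) : Matrix (Fin (2 * k)) (Fin (2 * k)) ℝ :=
  Mmat k (fun _ => c) (fun _ => c)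

/-- The permutation of `Fin (2 * k)` exchanging the two blocks of `k` indices. -/
def blockSwap (k : ℕ) : Equiv.Perm (Fin (2 * k)) :=
  finProdFinEquiv.permCongr (Equiv.prodCongrLeft fun _ : Fin k => Equiv.swap (0 : Fin 2) 1)

theorem sign_blockSwap (k : ℕ) : Equiv.Perm.sign (blockSwap k) = (-1) ^ k := by
  simp [blockSwap, Equiv.Perm.sign_permCongr, Equiv.Perm.sign_prodCongrLeft]

theorem blockSwap_apply_of_lt {k : ℕ} {i : Fin (2 * k)} (hi : (i : ℕ) < k) :
    (blockSwap k i : ℕ) = i + k := by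
  obtain ⟨⟨x, y⟩, rfl⟩ := finProdFinEquiv.surjective i
  fin_cases x
  · simp [blockSwap, Equiv.permCongr_apply]
  · simp at hi

theorem blockSwap_apply_of_le {k : ℕ} {i : Fin (2 * k)} (hi : k ≤ (i : ℕ)) :
    (blockSwap k i : ℕ) = i - k := by
  obtain ⟨⟨x, y⟩, rfl⟩ := finProdFinEquiv.surjective i
  fin_cases x
  · have := y.isLt
    simp at hi
    omega
  · simp [blockSwap, Equiv.permCongr_apply]

/-- The signs relating row `i` of `shiftedMat` to its row `blockSwap k i`. -/
def blockSign (k : ℕ) (i : Fin (2 * k)) : ℝ :=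
  (-1) ^ ((i : ℕ) % k + k + 1)

theorem prod_blockSign (k : ℕ) : ∏ i, blockSign k i = 1 := by
  rw [← finProdFinEquiv.prod_comp, Fintype.prod_prod_type, Fin.prod_univ_two,
    ← Finset.prod_mul_distrib]
  refine Finset.prod_eq_one fun y _ => ?_
  simp [blockSign, Nat.mod_eq_of_lt y.isLt, ← mul_pow]

theorem prod_neg_one_pow (k : ℕ) : ∏ j : Fin (2 * k), (-1 : ℝ) ^ (j : ℕ) = (-1) ^ k := by
  rw [Fin.prod_univ_eq_prod_range (fun j => (-1 : ℝ) ^ j)]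
  induction k with
  | zero => simp
  | succ k ih =>
    rw [show 2 * (k + 1) = 2 * k + 1 + 1 by ring, Finset.prod_range_succ,
      Finset.prod_range_succ, ih, pow_succ, pow_succ, pow_mul]
    simp

theorem shiftedMat_eq_blockSwap {k : ℕ} {c : ℕ} (i j : Fin (2 * k)) :
    shiftedMat k c i j =
      blockSign k i * ((-1) ^ (j : ℕ) * shiftedMat k c (blockSwap k i) j) := by
  have hs : ∀ n : ℕ, ((-1 : ℝ) ^ n) * (-1) ^ n = 1 := fun n => by simp [← mul_pow]
  by_cases hi : (i : ℕ) < k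
  · have h := blockSwap_apply_of_lt hi
    have h' : ¬ (blockSwap k i : ℕ) < k := by omega
    simp only [shiftedMat, Mmat, Matrix.of_apply, dif_pos hi, dif_neg h', blockSign,
      Nat.mod_eq_of_lt hi]
    simp only [h]
    push_cast
    rw [add_sub_cancel_right]
    generalize Γinv _ = g
    linear_combination (-g) * hs ((i : ℕ) + k + 1 + j)
  · have h := blockSwap_apply_of_le (not_lt.1 hi)
    have h' : (blockSwap k i : ℕ) < k := by omega
    have hm : (i : ℕ) % k = i - k := by
      rw [Nat.mod_eq_sub_mod (not_lt.1 hi), Nat.mod_eq_of_lt (by omega)]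
    simp only [shiftedMat, Mmat, Matrix.of_apply, dif_neg hi, dif_pos h', blockSign, hm]
    simp only [h]
    push_cast [not_lt.1 hi]
    rw [Nat.sub_add_cancel (not_lt.1 hi)]
    ring

/-- The determinant of `Mmat k 0 0` with row `i` shifted by `c`. -/
noncomputable def shiftDet (k c : ℕ) (i : Fin (2 * k)) : ℝ :=
  ((shiftedMat k 0).updateRow i (shiftedMat k c i)).det

theorem shiftDet_blockSwap (k c : ℕ) (i : Fin (2 * k)) :
    shiftDet k c (blockSwap k i) = shiftDet k c i := by
  have h : (shiftedMat k 0).updateRow i (shiftedMat k c i) =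
      Matrix.of fun i' j => blockSign k i' * Matrix.of (fun (i' j : Fin (2 * k)) =>
        (-1 : ℝ) ^ (j : ℕ) *
        ((shiftedMat k 0).updateRow (blockSwap k i)
          (shiftedMat k c (blockSwap k i))).submatrix (blockSwap k) id i' j) i' j := by
    ext i' j
    by_cases hi : i' = i
    · subst hi
      simp [shiftedMat_eq_blockSwap i' j]
    · simp [Matrix.updateRow_apply, hi, shiftedMat_eq_blockSwap i' j]
  unfold shiftDet
  rw [h, Matrix.det_mul_column, Matrix.det_mul_row, Matrix.det_permute, prod_blockSign,
    prod_neg_one_pow, sign_blockSwap]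
  push_cast
  rw [one_mul, ← mul_assoc, ← mul_pow]
  simp

theorem Γinv_of_le {m : ℤ} (h : m ≤ 0) : Γinv m = 0 :=
  if_neg (by omega)

theorem shiftedMat_two_eq_mul (k : ℕ) :
    shiftedMat k 2 = shiftedMat k 0 *
      Matrix.of fun l j : Fin (2 * k) => if (l : ℕ) = j + 2 then (1 : ℝ) else 0 := by
  ext i j
  rw [Matrix.mul_apply]
  simp only [Matrix.of_apply, mul_ite, mul_one, mul_zero]
  by_cases hj : (j : ℕ) + 2 < 2 * k
  · rw [Finset.sum_eq_single ⟨j + 2, hj⟩ (fun l _ hl => if_neg fun h => hl (Fin.ext h))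
      (by simp), if_pos rfl]
    simp only [shiftedMat, Mmat, Matrix.of_apply]
    split_ifs
    · congr 1
      push_cast
      ring
    · congr 1
      · ring
      · congr 1
        push_cast
        ring
  · rw [Finset.sum_eq_zero fun l _ => if_neg (by omega)]
    simp only [shiftedMat, Mmat, Matrix.of_apply]
    split_ifs
    · exact Γinv_of_le (by omega)
    · rw [Γinv_of_le (by omega), mul_zero]

theorem sum_det_updateRow_mul {n R : Type*} [Fintype n] [DecidableEq n] [CommRing R]
    (A T : Matrix n n R) :
    ∑ i, (A.updateRow i ((A * T) i)).det = A.det * T.trace := by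
  have h : ∀ i, (A.updateRow i ((A * T) i)).det = (A * T * A.adjugate) i i := fun i => by
    rw [← Matrix.cramer_transpose_apply, Matrix.cramer_eq_adjugate_mulVec,
      ← Matrix.adjugate_transpose, Matrix.mulVec_transpose]
    rfl
  calc _ = (A * T * A.adjugate).trace := Finset.sum_congr rfl fun i _ => h i
    _ = _ := by
      rw [Matrix.trace_mul_comm, ← mul_assoc, Matrix.adjugate_mul, smul_mul_assoc, one_mul,
        Matrix.trace_smul, smul_eq_mul]

theorem sum_shiftDet_two (k : ℕ) : ∑ i, shiftDet k 2 i = 0 := by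
  unfold shiftDet
  simp_rw [shiftedMat_two_eq_mul]
  rw [sum_det_updateRow_mul]
  simp [Matrix.trace]

theorem sum_shiftDet_two_top (k : ℕ) :
    ∑ i : Fin k, shiftDet k 2 (finProdFinEquiv (0, i)) = 0 := by
  have h := sum_shiftDet_two k
  have hswap (i : Fin k) : blockSwap k (finProdFinEquiv (0, i)) = finProdFinEquiv (1, i) := by
    simp [blockSwap, Equiv.permCongr_apply]
  rw [← finProdFinEquiv.sum_comp, Fintype.sum_prod_type, Fin.sum_univ_two] at h
  simp_rw [← hswap, shiftDet_blockSwap] at h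
  linarith

theorem Mtilde_single_zero (k : ℕ) (i : Fin k) (c : ℕ) :
    Mtilde k (Pi.single i c) 0 = shiftDet k c (finProdFinEquiv (0, i)) := by
  have h : Mmat k (Pi.single i c) 0 = (shiftedMat k 0).updateRow (finProdFinEquiv (0, i))
      (shiftedMat k c (finProdFinEquiv (0, i))) := by
    ext i' j
    by_cases hi : i' = finProdFinEquiv (0, i)
    · subst hi
      simp [shiftedMat, Mmat]
    · rw [Matrix.updateRow_ne hi]
      simp only [shiftedMat, Mmat, Matrix.of_apply]
      split_ifs with hk
      · rw [Pi.single_eq_of_ne]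
        rintro rfl
        exact hi (Fin.ext (by simp))
      · rfl
  simp [Mtilde, h, shiftDet]

theorem isRearrangement_nil_iff {k : ℕ} {b : Fin k → ℕ} : IsRearrangement k [] b ↔ b = 0 := by
  constructor
  · intro h
    funext i
    have hi : b i ∈ Multiset.map b Finset.univ.val := Multiset.mem_map_of_mem b (by simp)
    rw [h] at hi
    simpa using (Multiset.eq_of_mem_replicate (by simpa using hi))
  · rintro rfl
    simp [IsRearrangement]

theorem isRearrangement_singleton_iff {k c : ℕ} {a : Fin k → ℕ} :
    IsRearrangement k [c] a ↔ ∃ i, a = Pi.single i c := by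
  have key (i : Fin k) : Multiset.map a Finset.univ.val =
      a i ::ₘ Multiset.map a (Finset.univ.erase i).val := by
    rw [← Multiset.map_cons, Finset.erase_val, Multiset.cons_erase (by simp)]
  unfold IsRearrangement
  constructor
  · intro h
    have hmem : c ∈ Multiset.map a Finset.univ.val := by rw [h]; simp
    obtain ⟨i, -, hi⟩ := Multiset.mem_map.1 hmem
    refine ⟨i, funext fun j => ?_⟩
    by_cases hj : j = i
    · simp [hj, hi]
    · rw [Pi.single_eq_of_ne hj]
      rw [key i, hi, Multiset.coe_singleton, Multiset.singleton_add, Multiset.cons_inj_right] at h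
      have hm : a j ∈ Multiset.map a (Finset.univ.erase i).val :=
        Multiset.mem_map_of_mem a (Finset.mem_erase.2 ⟨hj, Finset.mem_univ j⟩)
      rw [h] at hm
      exact Multiset.eq_of_mem_replicate hm
  · rintro ⟨i, rfl⟩
    rw [key i, Pi.single_eq_same, Multiset.coe_singleton, Multiset.singleton_add,
      Multiset.cons_inj_right, Multiset.eq_replicate]
    refine ⟨by simp, fun x hx => ?_⟩
    obtain ⟨j, hj, rfl⟩ := Multiset.mem_map.1 hx
    exact Pi.single_eq_of_ne (Finset.ne_of_mem_erase (Finset.mem_def.2 hj)) _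

open Classical in
theorem finsum_rearrangements_singleton_nil {k c : ℕ} (hc : c ≠ 0)
    (f : (Fin k → ℕ) → (Fin k → ℕ) → ℝ) :
    (∑ᶠ (a : Fin k → ℕ) (b : Fin k → ℕ),
      if IsRearrangement k [c] a ∧ IsRearrangement k [] b then f a b else 0) =
      ∑ i, f (Pi.single i c) 0 := by
  have hb (a : Fin k → ℕ) : (∑ᶠ b : Fin k → ℕ,
      if IsRearrangement k [c] a ∧ IsRearrangement k [] b then f a b else 0) =
      if ∃ i, a = Pi.single i c then f a 0 else 0 := by
    rw [finsum_eq_single _ 0 fun b hb => if_neg fun h => hb (isRearrangement_nil_iff.1 h.2)]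
    simp [isRearrangement_nil_iff, isRearrangement_singleton_iff]
  simp_rw [hb]
  rw [finsum_eq_sum_of_support_subset (s := Finset.univ.image fun i => Pi.single i c),
    Finset.sum_image]
  · exact Finset.sum_congr rfl fun i _ => if_pos ⟨i, rfl⟩
  · intro i _ j _ hij
    by_contra hne
    have := congrFun hij i
    simp [hne, hc] at this
  · intro a ha
    obtain ⟨i, hi⟩ := (ite_ne_right_iff.1 ha).1
    simp [hi]

/-- `N_k((2);()) = 0` for every `k ≥ 1`. -/
theorem Nk_two_empty (k : ℕ) (hk : 1 ≤ k) :
    Nk k [2] [] = 0 := by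
  rw [Nk, finsum_rearrangements_singleton_nil two_ne_zero]
  simp_rw [Mtilde_single_zero]
  rw [sum_shiftDet_two_top, mul_zero]
end

section
/- Let s be a real number with s > 1. Then ∑_{p prime} p^{−s} = ∑_{m=1}^{∞} (μ(m)/m) · log‖ζ(ms)‖, where both series converge; here ζ is the Riemann zeta function (for real argument ms > 1 one has ζ(ms) real and positive, so ‖ζ(ms)‖ = ζ(ms)), μ is the Möbius function, and the left-hand sum runs over all prime numbers p. -/
open scoped BigOperators

/-- For real `x > 1`, `log ‖ζ(x)‖` is the sum over primes of `-log (1 - p^{-x})`. -/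
theorem hasSum_neg_log_one_sub_rpow_primes {x : ℝ} (hx : 1 < x) :
    HasSum (fun p : Nat.Primes => -Real.log (1 - (p : ℝ) ^ (-x)))
      (Real.log ‖riemannZeta (x : ℂ)‖) := by
  have hcast (p : Nat.Primes) : (((p : ℝ) ^ (-x) : ℝ) : ℂ) = (p : ℂ) ^ (-(x : ℂ)) := by
    rw [Complex.ofReal_cpow (Nat.cast_nonneg _)]
    push_cast
    rfl
  have hsum : Summable (fun p : Nat.Primes => (p : ℂ) ^ (-(x : ℂ))) := by
    simp_rw [← hcast]
    exact Complex.summable_ofReal.mpr (Nat.Primes.summable_rpow.mpr (by linarith))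
  have hlog : Real.log ‖riemannZeta (x : ℂ)‖
      = (∑' p : Nat.Primes, -Complex.log (1 - (p : ℂ) ^ (-(x : ℂ)))).re := by
    rw [← riemannZeta_eulerProduct_exp_log (s := (x : ℂ)) (by simpa using hx),
      Complex.norm_exp, Real.log_exp]
  rw [hlog]
  refine (Complex.hasSum_re hsum.clog_one_sub.neg.hasSum).congr_fun fun p => ?_
  have hp : (p : ℝ) ^ (-x) ≤ 1 :=
    Real.rpow_le_one_of_one_le_of_nonpos (by exact_mod_cast p.2.one_lt.le) (by linarith)
  rw [← hcast, Complex.neg_re, Complex.log_re, ← Complex.ofReal_one, ← Complex.ofReal_sub,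
    Complex.norm_real, Real.norm_of_nonneg (by linarith)]

/-- The double series `∑_{m, k ≥ 1} μ(m) q^{mk} / (mk)` converges absolutely for `|q| < 1`. -/
theorem summable_moebius_mul_pow_div {q : ℝ} (hq : |q| < 1) :
    Summable (fun c : ℕ+ × ℕ+ =>
      (ArithmeticFunction.moebius (c.1 : ℕ) : ℝ) * (q ^ (c.1 * c.2 : ℕ) / (c.1 * c.2 : ℕ))) := by
  refine Summable.of_norm_bounded
    (summable_prod_mul_pow (𝕜 := ℝ) 0 (r := |q|) (by simpa using hq)) fun c => ?_
  have hμ : |(ArithmeticFunction.moebius (c.1 : ℕ) : ℝ)| ≤ 1 := by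
    exact_mod_cast ArithmeticFunction.abs_moebius_le_one
  have hc : (1 : ℝ) ≤ (c.1 * c.2 : ℕ) := by exact_mod_cast (one_le : 1 ≤ c.1 * c.2)
  rw [norm_mul, norm_div, Real.norm_eq_abs, norm_pow, Real.norm_eq_abs, Real.norm_natCast, pow_zero]
  exact mul_le_mul hμ (div_le_self (by positivity) hc) (by positivity) zero_le_one

/-- Möbius inversion of the logarithmic series: `∑_{m, k ≥ 1} μ(m) q^{mk} / (mk) = q`. -/
theorem tsum_moebius_mul_pow_div {q : ℝ} (hq : |q| < 1) :
    ∑' c : ℕ+ × ℕ+,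
      (ArithmeticFunction.moebius (c.1 : ℕ) : ℝ) * (q ^ (c.1 * c.2 : ℕ) / (c.1 * c.2 : ℕ)) = q := by
  have hG := sigmaAntidiagonalEquivProd.summable_iff.mpr (summable_moebius_mul_pow_div hq)
  rw [← sigmaAntidiagonalEquivProd.tsum_eq]
  have key (n : ℕ+) : ∑' d : Nat.divisorsAntidiagonal n,
      (ArithmeticFunction.moebius (d.1.1 : ℕ) : ℝ) *
        (q ^ (d.1.1 * d.1.2 : ℕ) / (d.1.1 * d.1.2 : ℕ)) = if n = 1 then q else 0 := by
    rw [tsum_fintype, Finset.univ_eq_attach,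
      Finset.sum_attach _ (fun d : ℕ × ℕ => (ArithmeticFunction.moebius d.1 : ℝ) *
        (q ^ (d.1 * d.2 : ℕ) / (d.1 * d.2 : ℕ)))]
    have h : ∀ d ∈ Nat.divisorsAntidiagonal n, (ArithmeticFunction.moebius d.1 : ℝ) *
        (q ^ (d.1 * d.2 : ℕ) / (d.1 * d.2 : ℕ)) =
        (ArithmeticFunction.moebius d.1 : ℝ) * (q ^ (n : ℕ) / (n : ℕ)) := fun d hd => by
      rw [(Nat.mem_divisorsAntidiagonal.mp hd).1]
    rw [Finset.sum_congr rfl h, ← Finset.sum_mul,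
      Nat.sum_divisorsAntidiagonal (fun d _ => (ArithmeticFunction.moebius d : ℝ)),
      ← Int.cast_sum, ← ArithmeticFunction.coe_mul_zeta_apply,
      ArithmeticFunction.moebius_mul_coe_zeta, ArithmeticFunction.one_apply]
    by_cases hn : n = 1
    · simp [hn]
    · simp [hn]
  rw [Summable.tsum_sigma (by exact hG)]
  exact (tsum_congr key).trans (tsum_ite_eq 1 (fun _ => q))

/-- `∑_{m ≥ 1} (μ(m)/m) (-log (1 - q^m)) = q` for `|q| < 1`. -/
theorem hasSum_moebius_div_mul_neg_log_one_sub_pow {q : ℝ} (hq : |q| < 1) :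
    HasSum (fun m : ℕ => ((ArithmeticFunction.moebius (m + 1) : ℤ) : ℝ) / ((m : ℝ) + 1) *
      -Real.log (1 - q ^ (m + 1))) q := by
  have h := (summable_moebius_mul_pow_div hq).hasSum
  rw [tsum_moebius_mul_pow_div hq] at h
  have h' := h.prod_fiberwise (g := fun m : ℕ+ =>
    (ArithmeticFunction.moebius (m : ℕ) : ℝ) / m * -Real.log (1 - q ^ (m : ℕ))) fun m => by
    have hm : |q ^ (m : ℕ)| < 1 := by
      rw [abs_pow]
      exact pow_lt_one₀ (abs_nonneg _) hq m.ne_zero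
    rw [← Equiv.pnatEquivNat.symm.hasSum_iff]
    refine ((Real.hasSum_pow_div_log_of_abs_lt_one hm).mul_left _).congr_fun fun k => ?_
    simp only [Function.comp_apply, Equiv.pnatEquivNat_symm_apply, Nat.succPNat_coe,
      Nat.succ_eq_add_one, pow_mul]
    push_cast
    have : ((m : ℕ) : ℝ) ≠ 0 := by exact_mod_cast m.ne_zero
    field_simp
  rw [← Equiv.pnatEquivNat.symm.hasSum_iff] at h'
  refine h'.congr_fun fun m => ?_
  simp

/-- `|log (1 - t)| ≤ 2 t` for `0 ≤ t ≤ 1/2`. -/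
theorem abs_log_one_sub_le {t : ℝ} (h0 : 0 ≤ t) (h1 : t ≤ 1 / 2) :
    |Real.log (1 - t)| ≤ 2 * t := by
  rw [abs_of_nonpos (Real.log_nonpos (by linarith) (by linarith))]
  have h := Real.one_sub_inv_le_log_of_pos (x := 1 - t) (by linarith)
  have h2 : (1 - t)⁻¹ ≤ 1 + 2 * t := by
    rw [inv_le_iff_one_le_mul₀ (by linarith)]
    nlinarith
  linarith

/-- The double series `∑_{i, m} μ(m+1)/(m+1) (-log (1 - q_i^{m+1}))` converges absolutely
if `∑ q_i` converges and `0 ≤ q_i ≤ 1/2` for all `i`. -/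
theorem summable_moebius_div_mul_neg_log_one_sub_pow {ι : Type*} {q : ι → ℝ} (hq : Summable q)
    (hq0 : ∀ i, 0 ≤ q i) (hq1 : ∀ i, q i ≤ 1 / 2) :
    Summable (fun c : ι × ℕ =>
      ((ArithmeticFunction.moebius (c.2 + 1) : ℤ) : ℝ) / ((c.2 : ℝ) + 1) *
        -Real.log (1 - q c.1 ^ (c.2 + 1))) := by
  have hgeom : Summable (fun m : ℕ => 2 * (1 / 2 : ℝ) ^ m) :=
    summable_geometric_two.mul_left 2
  refine Summable.of_norm_bounded
    (hq.mul_of_nonneg hgeom hq0 fun m => by positivity) fun c => ?_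
  obtain ⟨p, m⟩ := c
  have hμ : |((ArithmeticFunction.moebius (m + 1) : ℤ) : ℝ)| ≤ 1 := by
    exact_mod_cast ArithmeticFunction.abs_moebius_le_one
  have hm : |(m : ℝ) + 1| = (m : ℝ) + 1 := abs_of_nonneg (by positivity)
  have hpow : q p ^ (m + 1) ≤ q p * (1 / 2) ^ m := by
    rw [pow_succ']
    exact mul_le_mul_of_nonneg_left (pow_le_pow_left₀ (hq0 p) (hq1 p) m) (hq0 p)
  have hhalf : q p ^ (m + 1) ≤ 1 / 2 :=
    (pow_le_of_le_one (hq0 p) ((hq1 p).trans (by norm_num)) (by simp)).trans (hq1 p)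
  have hlog := abs_log_one_sub_le (pow_nonneg (hq0 p) (m + 1)) hhalf
  have hcoef : |((ArithmeticFunction.moebius (m + 1) : ℤ) : ℝ)| / ((m : ℝ) + 1) ≤ 1 :=
    (div_le_self (abs_nonneg _) (by simp)).trans hμ
  calc _ = |((ArithmeticFunction.moebius (m + 1) : ℤ) : ℝ)| / ((m : ℝ) + 1) *
        |Real.log (1 - q p ^ (m + 1))| := by
        simp only [Real.norm_eq_abs, abs_mul, abs_div, abs_neg, hm]
    _ ≤ |Real.log (1 - q p ^ (m + 1))| :=
        mul_le_of_le_one_left (abs_nonneg _) hcoef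
    _ ≤ q p * (2 * (1 / 2) ^ m) := by linarith

/-- Möbius inversion of `L m = ∑_i -log (1 - q_i^{m+1})`: one has
`∑_i q_i = ∑_m μ(m+1)/(m+1) L m`. -/
theorem hasSum_moebius_div_mul_of_hasSum_neg_log {ι : Type*} {q : ι → ℝ} {L : ℕ → ℝ}
    (hq : Summable q) (hq0 : ∀ i, 0 ≤ q i) (hq1 : ∀ i, q i ≤ 1 / 2)
    (hL : ∀ m, HasSum (fun i => -Real.log (1 - q i ^ (m + 1))) (L m)) :
    HasSum (fun m : ℕ => ((ArithmeticFunction.moebius (m + 1) : ℤ) : ℝ) / ((m : ℝ) + 1) * L m)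
      (∑' i, q i) := by
  obtain ⟨A, hA⟩ := summable_moebius_div_mul_neg_log_one_sub_pow hq hq0 hq1
  have hrow : HasSum q A := by
    refine hA.prod_fiberwise fun i => ?_
    have hi : |q i| < 1 := by
      rw [abs_of_nonneg (hq0 i)]
      exact (hq1 i).trans_lt (by norm_num)
    simpa only using hasSum_moebius_div_mul_neg_log_one_sub_pow hi
  rw [hrow.tsum_eq]
  refine ((Equiv.prodComm ℕ ι).hasSum_iff.mpr hA).prod_fiberwise fun m => ?_
  simpa only [Function.comp_apply, Equiv.prodComm_apply, Prod.swap_prod_mk]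
    using (hL m).mul_left _

/-- `∑_p p^{−s} = ∑_{m=1}^∞ (μ(m)/m)·log‖ζ(ms)‖` for real `s > 1`,
and both series converge. -/
theorem sum_primes_eq_moebius_log_zeta (s : ℝ) (hs : 1 < s) :
    Summable (fun p : Nat.Primes => (p : ℝ) ^ (-s)) ∧
    Summable (fun m : ℕ =>
      ((ArithmeticFunction.moebius (m + 1) : ℤ) : ℝ) / ((m : ℝ) + 1) *
        Real.log ‖riemannZeta (((m : ℕ) + 1 : ℕ) * (s : ℂ))‖) ∧
    (∑' p : Nat.Primes, (p : ℝ) ^ (-s))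
      = ∑' m : ℕ,
          ((ArithmeticFunction.moebius (m + 1) : ℤ) : ℝ) / ((m : ℝ) + 1) *
            Real.log ‖riemannZeta (((m : ℕ) + 1 : ℕ) * (s : ℂ))‖ := by
  have hS : Summable (fun p : Nat.Primes => (p : ℝ) ^ (-s)) :=
    Nat.Primes.summable_rpow.mpr (by linarith)
  have hq0 (p : Nat.Primes) : 0 ≤ (p : ℝ) ^ (-s) := by positivity
  have hq1 (p : Nat.Primes) : (p : ℝ) ^ (-s) ≤ 1 / 2 := by
    have hp : (2 : ℝ) ≤ p := by exact_mod_cast p.2.two_le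
    calc (p : ℝ) ^ (-s) ≤ (p : ℝ) ^ (-1 : ℝ) :=
          Real.rpow_le_rpow_of_exponent_le (by linarith) (by linarith)
      _ ≤ 1 / 2 := by
          rw [Real.rpow_neg_one, one_div]
          exact inv_anti₀ two_pos hp
  have h := hasSum_moebius_div_mul_of_hasSum_neg_log hS hq0 hq1
    (L := fun m => Real.log ‖riemannZeta (((m : ℕ) + 1 : ℕ) * (s : ℂ))‖) fun m => by
    have hms : 1 < ((m + 1 : ℕ) : ℝ) * s := by
      have : (1 : ℝ) ≤ ((m + 1 : ℕ) : ℝ) := by exact_mod_cast Nat.le_add_left 1 m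
      nlinarith
    have h := hasSum_neg_log_one_sub_rpow_primes hms
    rw [Complex.ofReal_mul, Complex.ofReal_natCast] at h
    refine h.congr_fun fun p => ?_
    rw [← Real.rpow_natCast, ← Real.rpow_mul (Nat.cast_nonneg _), neg_mul, mul_comm s]
  exact ⟨hS, h.summable, h.tsum_eq.symm⟩
end

section
/- Let t be a real number with 0 < t < 1, let w be a complex number with |w| ≤ 1, and let c be a natural number. Then the c-th derivative at z = 0 of the function of a real variable z ↦ (1 − w·t^{1/2+z})^{−1} (taking values in ℂ, with t^{x} the real power of the positive real t) equals (log t)^c · ∑_{m=0}^{∞} w^m · t^{m/2} · m^c, and this series converges absolutely. -/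
open scoped BigOperators

lemma hasDerivAt_const_mul_ofReal_rpow {t : ℝ} (ht0 : 0 < t) (w : ℂ) (a z : ℝ) :
    HasDerivAt (fun z : ℝ => w * ((t ^ (a + z) : ℝ) : ℂ))
      (Real.log t * (w * ((t ^ (a + z) : ℝ) : ℂ))) z := by
  have h := (((hasDerivAt_id z).const_add a).const_rpow ht0).ofReal_comp.const_mul w
  refine h.congr_deriv ?_
  simp only [id_eq]
  push_cast
  ring

lemma norm_const_mul_ofReal_rpow_le {t : ℝ} (ht0 : 0 < t) (ht1 : t < 1) {w : ℂ} (hw : ‖w‖ ≤ 1)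
    {x y : ℝ} (hxy : x ≤ y) : ‖w * ((t ^ y : ℝ) : ℂ)‖ ≤ t ^ x := by
  rw [norm_mul, Complex.norm_real, Real.norm_of_nonneg (by positivity)]
  exact (mul_le_of_le_one_left (by positivity) hw).trans
    (Real.rpow_le_rpow_of_exponent_ge ht0 ht1.le hxy)

lemma hasDerivAt_tsum_pow_mul_geometric {t : ℝ} (ht0 : 0 < t) (ht1 : t < 1) {w : ℂ}
    (hw : ‖w‖ ≤ 1) (c : ℕ) {a z : ℝ} (hz : 0 < a + z) :
    HasDerivAt (fun z : ℝ => ∑' m : ℕ, (m : ℂ) ^ c * (w * ((t ^ (a + z) : ℝ) : ℂ)) ^ m)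
      (Real.log t * ∑' m : ℕ, (m : ℂ) ^ (c + 1) * (w * ((t ^ (a + z) : ℝ) : ℂ)) ^ m) z := by
  obtain ⟨b, hab, hbz⟩ := exists_between (show -a < z by linarith)
  have hr0 : 0 ≤ t ^ (a + b) := by positivity
  have hr1 : t ^ (a + b) < 1 := Real.rpow_lt_one ht0.le ht1 (by linarith)
  have hr : ‖t ^ (a + b)‖ < 1 := by rwa [Real.norm_of_nonneg hr0]
  have hq {y : ℝ} (hy : b < y) : ‖w * ((t ^ (a + y) : ℝ) : ℂ)‖ ≤ t ^ (a + b) :=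
    norm_const_mul_ofReal_rpow_le ht0 ht1 hw (by linarith)
  rw [← tsum_mul_left]
  refine hasDerivAt_tsum_of_isPreconnected
    (g' := fun (m : ℕ) (y : ℝ) =>
      Real.log t * ((m : ℂ) ^ (c + 1) * (w * ((t ^ (a + y) : ℝ) : ℂ)) ^ m))
    ((summable_pow_mul_geometric_of_norm_lt_one (c + 1) hr).mul_left |Real.log t|)
    isOpen_Ioi isPreconnected_Ioi (fun m y _ => ?_) (fun m y hy => ?_) (Set.mem_Ioi.2 hbz)
    (summable_pow_mul_geometric_of_norm_lt_one c ((hq hbz).trans_lt hr1)) (Set.mem_Ioi.2 hbz)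
  · refine (((hasDerivAt_const_mul_ofReal_rpow ht0 w a y).fun_pow m).const_mul
      ((m : ℂ) ^ c)).congr_deriv ?_
    cases m with
    | zero => simp
    | succ n => simp only [Nat.add_sub_cancel]; ring
  · rw [norm_mul, norm_mul, norm_pow, norm_pow, Complex.norm_real, Complex.norm_natCast,
      Real.norm_eq_abs]
    gcongr
    exact hq hy

lemma iteratedDeriv_one_sub_const_mul_ofReal_rpow_inv {t : ℝ} (ht0 : 0 < t) (ht1 : t < 1) {w : ℂ}
    (hw : ‖w‖ ≤ 1) (c : ℕ) {a z : ℝ} (hz : 0 < a + z) :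
    iteratedDeriv c (fun z : ℝ => (1 - w * ((t ^ (a + z) : ℝ) : ℂ))⁻¹) z =
      (Real.log t : ℂ) ^ c * ∑' m : ℕ, (m : ℂ) ^ c * (w * ((t ^ (a + z) : ℝ) : ℂ)) ^ m := by
  induction c generalizing z with
  | zero =>
    have hq : ‖w * ((t ^ (a + z) : ℝ) : ℂ)‖ < 1 :=
      (norm_const_mul_ofReal_rpow_le ht0 ht1 hw le_rfl).trans_lt (Real.rpow_lt_one ht0.le ht1 hz)
    simp [(hasSum_geometric_of_norm_lt_one hq).tsum_eq]
  | succ c ih =>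
    have h := (hasDerivAt_tsum_pow_mul_geometric ht0 ht1 hw c hz).const_mul
      ((Real.log t : ℂ) ^ c)
    rw [iteratedDeriv_succ, pow_succ, mul_assoc, ← h.deriv]
    refine Filter.EventuallyEq.deriv_eq ?_
    filter_upwards [Ioi_mem_nhds (show -a < z by linarith)] with y hy
    exact ih (by linarith [Set.mem_Ioi.1 hy])

/-- the `c`-th derivative at `z = 0` of `z ↦ (1 − w·t^{1/2+z})⁻¹` equals
`(log t)^c · ∑_{m≥0} w^m t^{m/2} m^c`, and the series converges absolutely. -/
theorem iteratedDeriv_geometric_factor (t : ℝ) (ht0 : 0 < t) (ht1 : t < 1)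
    (w : ℂ) (hw : ‖w‖ ≤ 1) (c : ℕ) :
    iteratedDeriv c (fun z : ℝ => (1 - w * ((t ^ ((1 : ℝ) / 2 + z) : ℝ) : ℂ))⁻¹) 0
      = ((Real.log t : ℂ)) ^ c *
          ∑' m : ℕ, w ^ m * ((t ^ ((m : ℝ) / 2) : ℝ) : ℂ) * (m : ℂ) ^ c ∧
    Summable (fun m : ℕ => ‖w ^ m * ((t ^ ((m : ℝ) / 2) : ℝ) : ℂ) * (m : ℂ) ^ c‖) := by
  have hterm (m : ℕ) : w ^ m * ((t ^ ((m : ℝ) / 2) : ℝ) : ℂ) * (m : ℂ) ^ c =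
      (m : ℂ) ^ c * (w * ((t ^ ((1 : ℝ) / 2 + 0) : ℝ) : ℂ)) ^ m := by
    rw [mul_pow, ← Complex.ofReal_pow, ← Real.rpow_mul_natCast ht0.le, mul_comm, add_zero,
      one_div_mul_eq_div]
  have hq : ‖w * ((t ^ ((1 : ℝ) / 2 + 0) : ℝ) : ℂ)‖ < 1 :=
    (norm_const_mul_ofReal_rpow_le ht0 ht1 hw le_rfl).trans_lt
      (Real.rpow_lt_one ht0.le ht1 (by norm_num))
  simp only [hterm]
  exact ⟨iteratedDeriv_one_sub_const_mul_ofReal_rpow_inv ht0 ht1 hw c (by norm_num),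
    summable_norm_pow_mul_geometric_of_norm_lt_one c hq⟩
end
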